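/- (Proposition 1.) Each agent i=1,2 can restrict itself to strategies of the form Mⁱ_t ∼ f̄ⁱ_t(Xⁱ_t,C_t,D_t) and Uⁱ_t ∼ ḡⁱ_t(Xⁱ_t,C_{t⁺},D_{t⁺}) without loss of optimality: the minimum over all team strategies (f,g) of max_{gᵃ} J((f,g),gᵃ) equals the minimum of max_{gᵃ} J((f̄,ḡ),gᵃ) taken only over strategies (f̄,ḡ) in which the communication decision at each t is a (randomized) function of (Xⁱ_t,C_t,D_t) and the control action at each t⁺ is a (randomized) function of (Xⁱ_t,C_{t⁺},D_{t⁺}); i.e., the past local states and actions Xⁱ_{1:t−1},Uⁱ_{1:t−1} are not needed for optimal decisions. -/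

import Mathlib

open Finset
open scoped Classical BigOperators

namespace TA

/-- The primitive model of the team-vs-adversary control system (Section II of the paper):
finite horizon `T`, finite global/local state spaces, finite action spaces, independent
initial states, controlled Markovian dynamics given by transition kernels, an erasure
parameter `pe`, an observation kernel `obs` for the adversary's observation `Y_t`,
a stage cost `cost` and a communication cost `commCost`. -/
structure Model where
  T : ℕ
  hT : 0 < T
  X0 : Type
  X1 : Type
  X2 : Type
  U1 : Type
  U2 : Type
  Ua : Type
  Y : Type
  [fX0 : Fintype X0]
  [fX1 : Fintype X1]
  [fX2 : Fintype X2]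
  [fU1 : Fintype U1]
  [fU2 : Fintype U2]
  [fUa : Fintype Ua]
  [fY : Fintype Y]
  [nX0 : Nonempty X0]
  [nX1 : Nonempty X1]
  [nX2 : Nonempty X2]
  [nU1 : Nonempty U1]
  [nU2 : Nonempty U2]
  [nUa : Nonempty Ua]
  [nY : Nonempty Y]
  init0 : X0 → ℝ
  init1 : X1 → ℝ
  init2 : X2 → ℝ
  trans0 : X0 → Ua → X0 → ℝ
  trans1 : X0 → X1 → U1 → X1 → ℝ
  trans2 : X0 → X2 → U2 → X2 → ℝ
  pe : X0 → ℝ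
  obs : Option (X1 × X2) → Bool × Bool → X0 → Y → ℝ
  cost : ℕ → X0 → X1 × X2 → U1 × U2 → Ua → ℝ
  commCost : X0 → X1 × X2 → ℝ
  init0_nonneg : ∀ x, 0 ≤ init0 x
  init1_nonneg : ∀ x, 0 ≤ init1 x
  init2_nonneg : ∀ x, 0 ≤ init2 x
  init0_sum : ∑ x, init0 x = 1
  init1_sum : ∑ x, init1 x = 1
  init2_sum : ∑ x, init2 x = 1
  trans0_nonneg : ∀ x u x', 0 ≤ trans0 x u x'
  trans1_nonneg : ∀ x0 x u x', 0 ≤ trans1 x0 x u x'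
  trans2_nonneg : ∀ x0 x u x', 0 ≤ trans2 x0 x u x'
  trans0_sum : ∀ x u, ∑ x', trans0 x u x' = 1
  trans1_sum : ∀ x0 x u, ∑ x', trans1 x0 x u x' = 1
  trans2_sum : ∀ x0 x u, ∑ x', trans2 x0 x u x' = 1
  pe_nonneg : ∀ x, 0 ≤ pe x
  pe_le_one : ∀ x, pe x ≤ 1
  obs_nonneg : ∀ z m x y, 0 ≤ obs z m x y
  obs_sum : ∀ z m x, ∑ y, obs z m x y = 1

attribute [instance] Model.fX0 Model.fX1 Model.fX2 Model.fU1 Model.fU2 Model.fUa Model.fY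
attribute [instance] Model.nX0 Model.nX1 Model.nX2 Model.nU1 Model.nU2 Model.nUa Model.nY

/-- A full system trajectory over the horizon: global states, local states, communication
decisions, messages over the erasure channel, adversary observations, and all actions. -/
abbrev Traj (M : Model) :=
  (Fin M.T → M.X0) × (Fin M.T → M.X1) × (Fin M.T → M.X2) ×
  (Fin M.T → Bool) × (Fin M.T → Bool) × (Fin M.T → Option (M.X1 × M.X2)) ×
  (Fin M.T → M.Y) × (Fin M.T → M.U1) × (Fin M.T → M.U2) × (Fin M.T → M.Ua)

def idx (M : Model) (t : ℕ) : Fin M.T := if h : t < M.T then ⟨t, h⟩ else ⟨0, M.hT⟩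

variable {M : Model}

def X0v (ω : Traj M) (t : ℕ) : M.X0 := ω.1 (idx M t)
def X1v (ω : Traj M) (t : ℕ) : M.X1 := ω.2.1 (idx M t)
def X2v (ω : Traj M) (t : ℕ) : M.X2 := ω.2.2.1 (idx M t)
def M1v (ω : Traj M) (t : ℕ) : Bool := ω.2.2.2.1 (idx M t)
def M2v (ω : Traj M) (t : ℕ) : Bool := ω.2.2.2.2.1 (idx M t)
def Zv (ω : Traj M) (t : ℕ) : Option (M.X1 × M.X2) := ω.2.2.2.2.2.1 (idx M t)
def Yv (ω : Traj M) (t : ℕ) : M.Y := ω.2.2.2.2.2.2.1 (idx M t)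
def U1v (ω : Traj M) (t : ℕ) : M.U1 := ω.2.2.2.2.2.2.2.1 (idx M t)
def U2v (ω : Traj M) (t : ℕ) : M.U2 := ω.2.2.2.2.2.2.2.2.1 (idx M t)
def UAv (ω : Traj M) (t : ℕ) : M.Ua := ω.2.2.2.2.2.2.2.2.2 (idx M t)
def Mv (ω : Traj M) (t : ℕ) : Bool × Bool := (M1v ω t, M2v ω t)

/-- The list of values `f 0, f 1, …, f (t-1)` (a "prefix" of a stochastic process). -/
def pre {α : Type _} (t : ℕ) (f : ℕ → α) : List α := (List.range t).map f

/-- Realizations of agent 1's information `I¹_t` (resp. `I¹_{t⁺}`):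
`(X⁰_{1:t}, X¹_{1:t}, U¹_{1:t-1}, M_{1:t-1}, Z^er_{1:t-1}, Uᵃ_{1:t-1}, Y_{1:t-1})`. -/
abbrev Hist1 (M : Model) :=
  List M.X0 × List M.X1 × List M.U1 × List (Bool × Bool) ×
  List (Option (M.X1 × M.X2)) × List M.Ua × List M.Y

/-- Realizations of agent 2's information `I²_t` (resp. `I²_{t⁺}`). -/
abbrev Hist2 (M : Model) :=
  List M.X0 × List M.X2 × List M.U2 × List (Bool × Bool) ×
  List (Option (M.X1 × M.X2)) × List M.Ua × List M.Y

/-- Realizations of the team's common information `C^team_t = I¹_t ∩ I²_t`. -/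
abbrev HistC (M : Model) :=
  List M.X0 × List (Bool × Bool) × List (Option (M.X1 × M.X2)) × List M.Ua × List M.Y

def info1 (t : ℕ) (ω : Traj M) : Hist1 M :=
  (pre (t+1) (X0v ω), pre (t+1) (X1v ω), pre t (U1v ω), pre t (Mv ω),
   pre t (Zv ω), pre t (UAv ω), pre t (Yv ω))

def info1p (t : ℕ) (ω : Traj M) : Hist1 M :=
  (pre (t+1) (X0v ω), pre (t+1) (X1v ω), pre t (U1v ω), pre (t+1) (Mv ω),
   pre (t+1) (Zv ω), pre t (UAv ω), pre (t+1) (Yv ω))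

def info2 (t : ℕ) (ω : Traj M) : Hist2 M :=
  (pre (t+1) (X0v ω), pre (t+1) (X2v ω), pre t (U2v ω), pre t (Mv ω),
   pre t (Zv ω), pre t (UAv ω), pre t (Yv ω))

def info2p (t : ℕ) (ω : Traj M) : Hist2 M :=
  (pre (t+1) (X0v ω), pre (t+1) (X2v ω), pre t (U2v ω), pre (t+1) (Mv ω),
   pre (t+1) (Zv ω), pre t (UAv ω), pre (t+1) (Yv ω))

/-- The team's common information `C^team_t` before communication at time `t`. -/
def teamCom (t : ℕ) (ω : Traj M) : HistC M :=
  (pre (t+1) (X0v ω), pre t (Mv ω), pre t (Zv ω), pre t (UAv ω), pre t (Yv ω))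

/-- The team's common information `C^team_{t⁺}` after communication at time `t`. -/
def teamComP (t : ℕ) (ω : Traj M) : HistC M :=
  (pre (t+1) (X0v ω), pre (t+1) (Mv ω), pre (t+1) (Zv ω), pre t (UAv ω), pre (t+1) (Yv ω))

/-- A behavioral communication/control strategy pair `(f,g) = (f¹,f²,g¹,g²)` for the team:
`fⁱ_t` selects a distribution on `{0,1}` for `Mⁱ_t` given `Iⁱ_t`; `gⁱ_t` selects a
distribution on `𝒰ⁱ` for `Uⁱ_t` given `Iⁱ_{t⁺}`. -/
structure TeamStrategy (M : Model) where
  f1 : ℕ → Hist1 M → Bool → ℝ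
  f2 : ℕ → Hist2 M → Bool → ℝ
  g1 : ℕ → Hist1 M → M.U1 → ℝ
  g2 : ℕ → Hist2 M → M.U2 → ℝ
  f1_nonneg : ∀ t h m, 0 ≤ f1 t h m
  f2_nonneg : ∀ t h m, 0 ≤ f2 t h m
  g1_nonneg : ∀ t h u, 0 ≤ g1 t h u
  g2_nonneg : ∀ t h u, 0 ≤ g2 t h u
  f1_sum : ∀ t h, ∑ m, f1 t h m = 1
  f2_sum : ∀ t h, ∑ m, f2 t h m = 1
  g1_sum : ∀ t h, ∑ u, g1 t h u = 1
  g2_sum : ∀ t h, ∑ u, g2 t h u = 1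

/-- A behavioral strategy for the adversary: `gᵃ_t` selects a distribution on `𝒰ᵃ`
given the adversary's information `Iᵃ_{t⁺}`, whose realizations live in `A`. -/
structure AdvStrategy (M : Model) (A : Type _) where
  ga : ℕ → A → M.Ua → ℝ
  ga_nonneg : ∀ t a u, 0 ≤ ga t a u
  ga_sum : ∀ t a, ∑ u, ga t a u = 1

/-- The kernel of the erasure channel: if `M^or_t = 0`, no message; if `M^or_t = 1`, the
joint local state is delivered w.p. `1 - pe(x⁰)` and erased w.p. `pe(x⁰)`. -/
noncomputable def zKer (M : Model) (x0 : M.X0) (m : Bool × Bool) (x : M.X1 × M.X2)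
    (z : Option (M.X1 × M.X2)) : ℝ :=
  if m = (false, false) then (if z = none then 1 else 0)
  else
    match z with
    | none => M.pe x0
    | some x' => if x' = x then 1 - M.pe x0 else 0

/-- The probability of a full trajectory under the team strategy `σ`, the adversary
strategy `γ`, where `iap t ω` is the realization of the adversary's information
`Iᵃ_{t⁺}` along `ω` (this parametrizes the adversary's information structure). -/
noncomputable def prob (σ : TeamStrategy M) {A : Type _} (γ : AdvStrategy M A)
    (iap : ℕ → Traj M → A) (ω : Traj M) : ℝ :=
  M.init0 (X0v ω 0) * M.init1 (X1v ω 0) * M.init2 (X2v ω 0) *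
  (∏ t ∈ Finset.range M.T,
    (σ.f1 t (info1 t ω) (M1v ω t) * σ.f2 t (info2 t ω) (M2v ω t) *
     zKer M (X0v ω t) (Mv ω t) (X1v ω t, X2v ω t) (Zv ω t) *
     M.obs (Zv ω t) (Mv ω t) (X0v ω t) (Yv ω t) *
     σ.g1 t (info1p t ω) (U1v ω t) * σ.g2 t (info2p t ω) (U2v ω t) *
     γ.ga t (iap t ω) (UAv ω t))) *
  (∏ t ∈ Finset.range (M.T - 1),
    (M.trans0 (X0v ω t) (UAv ω t) (X0v ω (t+1)) *
     M.trans1 (X0v ω t) (X1v ω t) (U1v ω t) (X1v ω (t+1)) *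
     M.trans2 (X0v ω t) (X2v ω t) (U2v ω t) (X2v ω (t+1))))

/-- Probability of an event (a set of trajectories). -/
noncomputable def pr (σ : TeamStrategy M) {A : Type _} (γ : AdvStrategy M A)
    (iap : ℕ → Traj M → A) (E : Traj M → Prop) : ℝ :=
  ∑ ω : Traj M, if E ω then prob σ γ iap ω else 0

/-- Conditional probability `P(F | E)`. -/
noncomputable def cpr (σ : TeamStrategy M) {A : Type _} (γ : AdvStrategy M A)
    (iap : ℕ → Traj M → A) (E F : Traj M → Prop) : ℝ :=
  pr σ γ iap (fun ω => F ω ∧ E ω) / pr σ γ iap E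

/-- Total cost `Σ_t c_t(X⁰_t,X_t,U_t,Uᵃ_t) + ρ(X⁰_t,X_t) 1{M^or_t = 1}` along a trajectory. -/
noncomputable def totalCost (ω : Traj M) : ℝ :=
  ∑ t ∈ Finset.range M.T,
    (M.cost t (X0v ω t) (X1v ω t, X2v ω t) (U1v ω t, U2v ω t) (UAv ω t) +
     (if (M1v ω t || M2v ω t) then M.commCost (X0v ω t) (X1v ω t, X2v ω t) else 0))

/-- Expected total cost `J((f,g),gᵃ)`. -/
noncomputable def J (σ : TeamStrategy M) {A : Type _} (γ : AdvStrategy M A)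
    (iap : ℕ → Traj M → A) : ℝ :=
  ∑ ω : Traj M, prob σ γ iap ω * totalCost ω

end TA
namespace TA

/-- An abstract information structure for the adversary satisfying the structural parts of
Assumption 1: the common information `C_t = Iᵃ_t` (resp. `C_{t⁺} = Iᵃ_{t⁺}`) and the team's
common private information `D_t = P¹_t ∩ P²_t` (resp. `D_{t⁺}`) are deterministic functions
of the trajectory; together, `(C_t, D_t)` carries exactly the team's common information
`C^team_t = I¹_t ∩ I²_t` (nestedness: `C_t ⊆ I¹_t ∩ I²_t` and `C_t ∪ D_t = C^team_t`);
and the adversary's information grows with time (monotonicity: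
`Iᵃ_t ⊆ Iᵃ_{t⁺} ⊆ Iᵃ_{t+1}`, expressed as: finer information determines coarser one). -/
structure InfoStructure (M : Model) where
  C : Type
  D : Type
  infoC : ℕ → Traj M → C
  infoCp : ℕ → Traj M → C
  infoD : ℕ → Traj M → D
  infoDp : ℕ → Traj M → D
  cd_team : ∀ (t : ℕ) (ω ω' : Traj M),
    (infoC t ω = infoC t ω' ∧ infoD t ω = infoD t ω') ↔ teamCom t ω = teamCom t ω'
  cdp_team : ∀ (t : ℕ) (ω ω' : Traj M),
    (infoCp t ω = infoCp t ω' ∧ infoDp t ω = infoDp t ω') ↔ teamComP t ω = teamComP t ω'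
  mono1 : ∀ (t : ℕ) (ω ω' : Traj M), infoCp t ω = infoCp t ω' → infoC t ω = infoC t ω'
  mono2 : ∀ (t : ℕ) (ω ω' : Traj M), infoC (t+1) ω = infoC (t+1) ω' → infoCp t ω = infoCp t ω'

end TA

namespace TA

/-- A team strategy is *simplified* (game `G_s`) if each agent's communication decision at
time `t` depends on its information only through `(Xⁱ_t, C_t, D_t)` and its control action
at time `t⁺` depends only on `(Xⁱ_t, C_{t⁺}, D_{t⁺})`; i.e., the past local states and
actions `Xⁱ_{1:t-1}, Uⁱ_{1:t-1}` are ignored. -/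
def Simplified {M : Model} (IS : InfoStructure M) (σ : TeamStrategy M) : Prop :=
  (∀ (t : ℕ) (ω ω' : Traj M), X1v ω t = X1v ω' t → IS.infoC t ω = IS.infoC t ω' →
      IS.infoD t ω = IS.infoD t ω' → σ.f1 t (info1 t ω) = σ.f1 t (info1 t ω')) ∧
  (∀ (t : ℕ) (ω ω' : Traj M), X2v ω t = X2v ω' t → IS.infoC t ω = IS.infoC t ω' →
      IS.infoD t ω = IS.infoD t ω' → σ.f2 t (info2 t ω) = σ.f2 t (info2 t ω')) ∧
  (∀ (t : ℕ) (ω ω' : Traj M), X1v ω t = X1v ω' t → IS.infoCp t ω = IS.infoCp t ω' →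
      IS.infoDp t ω = IS.infoDp t ω' → σ.g1 t (info1p t ω) = σ.g1 t (info1p t ω')) ∧
  (∀ (t : ℕ) (ω ω' : Traj M), X2v ω t = X2v ω' t → IS.infoCp t ω = IS.infoCp t ω' →
      IS.infoDp t ω = IS.infoDp t ω' → σ.g2 t (info2p t ω) = σ.g2 t (info2p t ω'))

/-- The min-max (upper) value `S^u(G)` of the original game `G`. -/
noncomputable def SuG (M : Model) (IS : InfoStructure M) : ℝ :=
  ⨅ σ : TeamStrategy M, ⨆ γ : AdvStrategy M IS.C, J σ γ IS.infoCp

/-- The min-max (upper) value `S^u(G_s)` of the simplified game `G_s`: same dynamics and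
cost as `G`, but the team is restricted to simplified strategies. -/
noncomputable def SuGs (M : Model) (IS : InfoStructure M) : ℝ :=
  ⨅ σ : {σ : TeamStrategy M // Simplified IS σ}, ⨆ γ : AdvStrategy M IS.C, J σ.1 γ IS.infoCp

end TA

namespace TA

/-- Iterated sum over the first `n` coordinates of a path, starting from a default path. -/
noncomputable def isum {S : Type} [Fintype S] (d : ℕ → S) : ℕ → ((ℕ → S) → ℝ) → ℝ
  | 0, F => F d
  | n+1, F => isum d n (fun w => ∑ s, F (Function.update w n s))

section isumLemmas
variable {S : Type} [Fintype S] (d : ℕ → S)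

lemma isum_add (n : ℕ) (F G : (ℕ → S) → ℝ) :
    isum d n (fun w => F w + G w) = isum d n F + isum d n G := by
  induction n generalizing F G with
  | zero => rfl
  | succ n ih => simp only [isum, Finset.sum_add_distrib, ih]

lemma isum_zero (n : ℕ) : isum d n (fun _ => 0) = 0 := by
  induction n with
  | zero => rfl
  | succ n ih => simp only [isum, Finset.sum_const_zero, ih]

lemma isum_mul_left (n : ℕ) (a : ℝ) (F : (ℕ → S) → ℝ) :
    isum d n (fun w => a * F w) = a * isum d n F := by
  induction n generalizing F with
  | zero => rfl
  | succ n ih => simp only [isum, ← Finset.mul_sum, ih]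

lemma isum_sum {ι : Type} (I : Finset ι) (n : ℕ) (F : ι → (ℕ → S) → ℝ) :
    isum d n (fun w => ∑ i ∈ I, F i w) = ∑ i ∈ I, isum d n (F i) := by
  induction I using Finset.induction_on with
  | empty => simp [isum_zero]
  | insert i I hi ih => simp only [Finset.sum_insert hi, isum_add, ih]

lemma isum_nonneg (n : ℕ) (F : (ℕ → S) → ℝ) (h : ∀ w, 0 ≤ F w) : 0 ≤ isum d n F := by
  induction n generalizing F with
  | zero => exact h _
  | succ n ih => exact ih _ (fun w => Finset.sum_nonneg fun s _ => h _)

lemma isum_mono (n : ℕ) (F G : (ℕ → S) → ℝ) (h : ∀ w, F w ≤ G w) :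
    isum d n F ≤ isum d n G := by
  induction n generalizing F G with
  | zero => exact h _
  | succ n ih => exact ih _ _ (fun w => Finset.sum_le_sum fun s _ => h _)

lemma isum_prod {A B : Type} [Fintype A] [Fintype B] (a : ℕ → A) (b : ℕ → B) (n : ℕ)
    (F : (ℕ → A × B) → ℝ) :
    isum (fun t => (a t, b t)) n F
      = isum a n (fun v => isum b n (fun w => F (fun t => (v t, w t)))) := by
  induction n generalizing F with
  | zero => rfl
  | succ n ih =>
    have hup : ∀ (v : ℕ → A) (w : ℕ → B) (x : A) (y : B),
        (fun t => (Function.update v n x t, Function.update w n y t)) =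
          Function.update (fun t => (v t, w t)) n (x, y) := by
      intro v w x y
      funext t
      by_cases h : t = n
      · subst h; simp
      · simp [h]
    simp only [isum, ih, ← isum_sum, Fintype.sum_prod_type, hup]

/-- Extension of a finite path by the default path. -/
def ext (n : ℕ) (v : Fin n → S) : ℕ → S := fun t => if h : t < n then v ⟨t, h⟩ else d t

lemma sum_ext (n : ℕ) (F : (ℕ → S) → ℝ) : ∑ v : Fin n → S, F (ext d n v) = isum d n F := by
  induction n generalizing F with
  | zero =>
    simp only [isum, Fintype.sum_unique]
    congr 1
  | succ n ih =>
    rw [isum, ← ih, ← (Fin.snocEquiv (fun _ : Fin (n+1) => S)).sum_comp, Fintype.sum_prod_type,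
      Finset.sum_comm]
    congr! 3 with v _ s
    funext t
    by_cases h : t = n
    · subst h
      simp only [ext, Fin.snocEquiv, Equiv.coe_fn_mk, Function.update_self, Nat.lt_succ_self,
        dite_true]
      exact Fin.snoc_last (α := fun _ => S) s v
    · by_cases h' : t < n
      · have : t < n + 1 := by omega
        simp only [ext, Fin.snocEquiv, Equiv.coe_fn_mk, Function.update_of_ne h, h', this,
          dite_true]
        exact Fin.snoc_castSucc (α := fun _ => S) s v ⟨t, h'⟩
      · have : ¬ t < n + 1 := by omega
        simp [ext, Function.update_of_ne h, h', this]

end isumLemmas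

section preLemmas

lemma pre_congr {α : Type} (t : ℕ) {f g : ℕ → α} (h : ∀ s, s < t → f s = g s) :
    pre t f = pre t g := by
  unfold pre
  exact List.map_congr_left fun s hs => h s (List.mem_range.1 hs)

lemma pre_inj {α : Type} {t : ℕ} {f g : ℕ → α} (h : pre t f = pre t g) :
    ∀ s, s < t → f s = g s := by
  unfold pre at h
  intro s hs
  exact List.map_inj_left.1 h s (List.mem_range.2 hs)

lemma pre_succ {α : Type} (t : ℕ) (f : ℕ → α) : pre (t+1) f = pre t f ++ [f t] := by
  simp [pre, List.range_succ]

end preLemmas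

/-- Common part of a step. -/
abbrev CS (M : Model) := M.X0 × (Bool × Bool) × Option (M.X1 × M.X2) × M.Y × M.Ua

/-- Generic histories of an agent. -/
abbrev HG (M : Model) (X U : Type) :=
  List M.X0 × List X × List U × List (Bool × Bool) ×
  List (Option (M.X1 × M.X2)) × List M.Ua × List M.Y

set_option linter.unusedSectionVars false

section agent
variable {M : Model} {X U : Type}

def tcm (t : ℕ) (c : ℕ → CS M) : HistC M :=
  (pre (t+1) (fun s => (c s).1), pre t (fun s => (c s).2.1), pre t (fun s => (c s).2.2.1),
    pre t (fun s => (c s).2.2.2.2), pre t (fun s => (c s).2.2.2.1))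

def tcp (t : ℕ) (c : ℕ → CS M) : HistC M :=
  (pre (t+1) (fun s => (c s).1), pre (t+1) (fun s => (c s).2.1),
    pre (t+1) (fun s => (c s).2.2.1),
    pre t (fun s => (c s).2.2.2.2), pre (t+1) (fun s => (c s).2.2.2.1))

/-- Agent history from common information, private past and current state. -/
def hG (t : ℕ) (k : HistC M) (w : ℕ → X × U) (x : X) : HG M X U :=
  (k.1, pre t (fun s => (w s).1) ++ [x], pre t (fun s => (w s).2), k.2.1, k.2.2.1, k.2.2.2.1,
    k.2.2.2.2)

lemma hG_inj {t : ℕ} {k k' : HistC M} {w w' : ℕ → X × U} {x x' : X}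
    (h : hG t k w x = hG t k' w' x') : k = k' ∧ x = x' := by
  simp only [hG, Prod.mk.injEq] at h
  obtain ⟨h1, h2, h3, h4, h5, h6, h7⟩ := h
  refine ⟨?_, ?_⟩
  · ext1; · exact h1
    ext1; · exact h4
    ext1; · exact h5
    ext1; · exact h6
    exact h7
  · have := List.append_inj_right' h2 rfl
    simpa using this

lemma hG_update (t n : ℕ) (hn : t ≤ n) (k : HistC M) (w : ℕ → X × U) (p : X × U) (x : X) :
    hG t k (Function.update w n p) x = hG t k w x := by
  have h : ∀ s, s < t → Function.update w n p s = w s := fun s hs =>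
    Function.update_of_ne (by omega) _ _
  simp only [hG]
  rw [pre_congr t (f := fun s => (Function.update w n p s).1) (g := fun s => (w s).1)
    (fun s hs => by simp only [h s hs]),
    pre_congr t (f := fun s => (Function.update w n p s).2) (g := fun s => (w s).2)
    (fun s hs => by simp only [h s hs])]

lemma tcm_agree {t : ℕ} {c c' : ℕ → CS M} (h : tcm t c = tcm t c') :
    ∀ s, s < t → c s = c' s := by
  simp only [tcm, Prod.mk.injEq] at h
  obtain ⟨h1, h2, h3, h4, h5⟩ := h
  intro s hs
  ext1; · exact pre_inj h1 s (by omega)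
  ext1; · exact pre_inj h2 s hs
  ext1; · exact pre_inj h3 s hs
  ext1; · exact pre_inj h5 s hs
  exact pre_inj h4 s hs

lemma tcp_tcm {t : ℕ} {c c' : ℕ → CS M} (h : tcp t c = tcp t c') :
    tcm t c = tcm t c' ∧ (c t).2.1 = (c' t).2.1 := by
  simp only [tcp, Prod.mk.injEq] at h
  obtain ⟨h1, h2, h3, h4, h5⟩ := h
  refine ⟨?_, pre_inj h2 t (by omega)⟩
  simp only [tcm, Prod.mk.injEq]
  exact ⟨h1, pre_congr t fun s hs => pre_inj h2 s (by omega),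
    pre_congr t fun s hs => pre_inj h3 s (by omega), h4,
    pre_congr t fun s hs => pre_inj h5 s (by omega)⟩

lemma tcm_congr {t : ℕ} {c c' : ℕ → CS M} (h : ∀ s, s ≤ t → c s = c' s) :
    tcm t c = tcm t c' := by
  simp only [tcm, Prod.mk.injEq]
  refine ⟨?_, ?_, ?_, ?_, ?_⟩ <;> exact pre_congr _ fun s hs => by rw [h s (by omega)]

lemma tcp_congr {t : ℕ} {c c' : ℕ → CS M} (h : ∀ s, s ≤ t → c s = c' s) :
    tcp t c = tcp t c' := by
  simp only [tcp, Prod.mk.injEq]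
  refine ⟨?_, ?_, ?_, ?_, ?_⟩ <;> exact pre_congr _ fun s hs => by rw [h s (by omega)]

variable (M X U) in
/-- Data of one agent's private dynamics. -/
structure Ag where
  ini : X → ℝ
  q : M.X0 → X → U → X → ℝ
  mi : Bool × Bool → Bool
  ze : CS M → X → ℝ
  ini_nonneg : ∀ x, 0 ≤ ini x
  q_nonneg : ∀ x0 x u x', 0 ≤ q x0 x u x'
  ze_nonneg : ∀ c x, 0 ≤ ze c x

variable (M X U) in
/-- A behavioral strategy of one agent. -/
structure Beh [Fintype U] where
  f : ℕ → HG M X U → Bool → ℝ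
  g : ℕ → HG M X U → U → ℝ
  f_nonneg : ∀ t h m, 0 ≤ f t h m
  g_nonneg : ∀ t h u, 0 ≤ g t h u
  f_sum : ∀ t h, ∑ m, f t h m = 1
  g_sum : ∀ t h, ∑ u, g t h u = 1

def Ag.tr (A : Ag M X U) : ℕ → (ℕ → CS M) → (ℕ → X × U) → X → ℝ
  | 0, _, _, x => A.ini x
  | t+1, c, w, x => A.q (c t).1 (w t).1 (w t).2 x

variable [Fintype X] [Fintype U]

noncomputable def Lfac (A : Ag M X U) (B : Beh M X U) (c : ℕ → CS M) (s : ℕ) (w : ℕ → X × U) (p : X × U) : ℝ :=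
  A.tr s c w p.1 * B.f s (hG s (tcm s c) w p.1) (A.mi (c s).2.1) *
    A.ze (c s) p.1 * B.g s (hG s (tcp s c) w p.1) p.2

noncomputable def Lw (A : Ag M X U) (B : Beh M X U) (c : ℕ → CS M) (t : ℕ) (w : ℕ → X × U) : ℝ :=
  ∏ s ∈ Finset.range t, Lfac A B c s w (w s)

lemma tr_update (A : Ag M X U) (t n : ℕ) (hn : t ≤ n) (c : ℕ → CS M) (w : ℕ → X × U)
    (p : X × U) (x : X) : A.tr t c (Function.update w n p) x = A.tr t c w x := by
  cases t with
  | zero => rfl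
  | succ t => simp only [Ag.tr]; rw [Function.update_of_ne (by omega)]

lemma tr_congr (A : Ag M X U) (t : ℕ) (c c' : ℕ → CS M) (h : ∀ s, s < t → c s = c' s)
    (w : ℕ → X × U) (x : X) : A.tr t c w x = A.tr t c' w x := by
  cases t with
  | zero => rfl
  | succ t => simp only [Ag.tr]; rw [h t (by omega)]

lemma tr_nonneg (A : Ag M X U) (t : ℕ) (c : ℕ → CS M) (w : ℕ → X × U) (x : X) :
    0 ≤ A.tr t c w x := by
  cases t with
  | zero => exact A.ini_nonneg _
  | succ t => exact A.q_nonneg _ _ _ _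

lemma Lfac_update (A : Ag M X U) (B : Beh M X U) (c : ℕ → CS M) (t n : ℕ) (hn : t ≤ n)
    (w : ℕ → X × U) (p p' : X × U) :
    Lfac A B c t (Function.update w n p) p' = Lfac A B c t w p' := by
  simp only [Lfac, tr_update A t n hn, hG_update t n hn]

lemma Lfac_congr (A : Ag M X U) (B : Beh M X U) (c c' : ℕ → CS M) (t : ℕ)
    (h : ∀ s, s ≤ t → c s = c' s) (w : ℕ → X × U) (p : X × U) :
    Lfac A B c t w p = Lfac A B c' t w p := by
  simp only [Lfac, tr_congr A t c c' (fun s hs => h s hs.le), tcm_congr h, tcp_congr h,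
    h t le_rfl]

lemma Lw_update (A : Ag M X U) (B : Beh M X U) (c : ℕ → CS M) (t n : ℕ) (hn : t ≤ n)
    (w : ℕ → X × U) (p : X × U) : Lw A B c t (Function.update w n p) = Lw A B c t w := by
  refine Finset.prod_congr rfl fun s hs => ?_
  have := Finset.mem_range.1 hs
  rw [Lfac_update A B c s n (by omega), Function.update_of_ne (by omega)]

lemma Lw_congr (A : Ag M X U) (B : Beh M X U) (c c' : ℕ → CS M) (t : ℕ)
    (h : ∀ s, s < t → c s = c' s) (w : ℕ → X × U) : Lw A B c t w = Lw A B c' t w := by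
  refine Finset.prod_congr rfl fun s hs => ?_
  have := Finset.mem_range.1 hs
  exact Lfac_congr A B c c' s (fun r hr => h r (by omega)) w _

lemma Lw_nonneg (A : Ag M X U) (B : Beh M X U) (c : ℕ → CS M) (t : ℕ) (w : ℕ → X × U) :
    0 ≤ Lw A B c t w := by
  refine Finset.prod_nonneg fun s _ => ?_
  have h1 := tr_nonneg A s c w (w s).1
  have h2 := B.f_nonneg s (hG s (tcm s c) w (w s).1) (A.mi (c s).2.1)
  have h3 := A.ze_nonneg (c s) (w s).1
  have h4 := B.g_nonneg s (hG s (tcp s c) w (w s).1) (w s).2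
  unfold Lfac
  positivity

noncomputable def denF (d : ℕ → X × U) (A : Ag M X U) (B : Beh M X U) (t : ℕ) (c : ℕ → CS M) (x : X) : ℝ :=
  isum d t (fun w => Lw A B c t w * A.tr t c w x)

noncomputable def numF (d : ℕ → X × U) (A : Ag M X U) (B : Beh M X U) (t : ℕ) (c : ℕ → CS M) (x : X)
    (m : Bool) : ℝ :=
  isum d t (fun w => Lw A B c t w * A.tr t c w x * B.f t (hG t (tcm t c) w x) m)

noncomputable def numG (d : ℕ → X × U) (A : Ag M X U) (B : Beh M X U) (t : ℕ) (c : ℕ → CS M) (x : X)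
    (u : U) : ℝ :=
  isum d t (fun w => Lw A B c t w * A.tr t c w x *
    B.f t (hG t (tcm t c) w x) (A.mi (c t).2.1) * B.g t (hG t (tcp t c) w x) u)

/-- Key relations between `B` and a strategy `B'`. -/
structure Rel (d : ℕ → X × U) (A : Ag M X U) (B B' : Beh M X U) (c : ℕ → CS M)
    (a : ℕ → X → Bool → ℝ) (b : ℕ → X → U → ℝ) : Prop where
  hf : ∀ t w x m, B'.f t (hG t (tcm t c) w x) m = a t x m
  hg : ∀ t w x u, B'.g t (hG t (tcp t c) w x) u = b t x u
  ha : ∀ t x m, a t x m * denF d A B t c x = numF d A B t c x m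
  hb : ∀ t x u, b t x u * numF d A B t c x (A.mi (c t).2.1) = numG d A B t c x u

lemma step_eq (d : ℕ → X × U) (A : Ag M X U) (B : Beh M X U) (c : ℕ → CS M)
    (a : ℕ → X → Bool → ℝ) (b : ℕ → X → U → ℝ)
    (ha : ∀ t x m, a t x m * denF d A B t c x = numF d A B t c x m)
    (hb : ∀ t x u, b t x u * numF d A B t c x (A.mi (c t).2.1) = numG d A B t c x u)
    (t : ℕ) (φ : X × U → ℝ) :
    isum d (t+1) (fun w => Lw A B c (t+1) w * φ (w t)) =
      ∑ p : X × U, φ p * A.ze (c t) p.1 * (b t p.1 p.2 *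
        (a t p.1 (A.mi (c t).2.1) * denF d A B t c p.1)) := by
  simp only [ha, hb]
  simp only [isum, numG, ← isum_mul_left, ← isum_sum]
  congr 1
  funext w
  refine Finset.sum_congr rfl fun p _ => ?_
  rw [Lw, Finset.prod_range_succ, ← Lw, Lw_update A B c t t le_rfl, Function.update_self,
    Lfac_update A B c t t le_rfl, Lfac]
  ring

lemma den_eq (d : ℕ → X × U) (A : Ag M X U) (B B' : Beh M X U) (c : ℕ → CS M)
    (a : ℕ → X → Bool → ℝ) (b : ℕ → X → U → ℝ) (h : Rel d A B B' c a b) (t : ℕ) :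
    ((∀ x, denF d A B t c x = denF d A B' t c x)) ∧ ∀ φ : X × U → ℝ,
    isum d (t+1) (fun w => Lw A B c (t+1) w * φ (w t)) =
    isum d (t+1) (fun w => Lw A B' c (t+1) w * φ (w t)) := by
  have ha' : ∀ t x m, a t x m * denF d A B' t c x = numF d A B' t c x m := by
    intro t x m
    simp only [denF, numF, h.hf, ← isum_mul_left]
    congr 1; funext w; ring
  have hb' : ∀ t x u, b t x u * numF d A B' t c x (A.mi (c t).2.1) = numG d A B' t c x u := by
    intro t x u
    simp only [numG, numF, h.hf, h.hg, ← isum_mul_left]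
    congr 1; funext w; ring
  have key : ∀ t, (∀ x, denF d A B t c x = denF d A B' t c x) → ∀ φ : X × U → ℝ,
    isum d (t+1) (fun w => Lw A B c (t+1) w * φ (w t)) =
    isum d (t+1) (fun w => Lw A B' c (t+1) w * φ (w t)) := by
    intro t ih φ
    rw [step_eq d A B c a b h.ha h.hb, step_eq d A B' c a b ha' hb']
    simp only [ih]
  induction t with
  | zero =>
    have : ∀ x, denF d A B 0 c x = denF d A B' 0 c x := by
      intro x; simp [denF, isum, Lw]
    exact ⟨this, key 0 this⟩
  | succ t ih =>
    have : ∀ x, denF d A B (t+1) c x = denF d A B' (t+1) c x := by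
      intro x
      exact ih.2 (fun p => A.q (c t).1 p.1 p.2 x)
    exact ⟨this, key _ this⟩

noncomputable def pm {α : Type} [Nonempty α] (x : α) : ℝ :=
  if x = Classical.arbitrary α then 1 else 0

lemma pm_nonneg {α : Type} [Nonempty α] (x : α) : 0 ≤ pm x := by
  unfold pm; split_ifs <;> norm_num

lemma pm_sum {α : Type} [Fintype α] [Nonempty α] : ∑ x : α, pm x = 1 := by simp [pm]

noncomputable def ratio {α : Type} [Nonempty α] (n : α → ℝ) (D : ℝ) (x : α) : ℝ :=
  if D = 0 then pm x else n x / D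

lemma ratio_nonneg {α : Type} [Nonempty α] (n : α → ℝ) (D : ℝ) (hn : ∀ x, 0 ≤ n x) (hD : 0 ≤ D)
    (x : α) : 0 ≤ ratio n D x := by
  unfold ratio; split_ifs
  · exact pm_nonneg x
  · exact div_nonneg (hn x) hD

lemma ratio_sum {α : Type} [Fintype α] [Nonempty α] (n : α → ℝ) (D : ℝ) (h : ∑ x, n x = D) :
    ∑ x, ratio n D x = 1 := by
  unfold ratio; split_ifs with h0
  · exact pm_sum
  · rw [← Finset.sum_div, h, div_self h0]

lemma ratio_mul {α : Type} [Fintype α] [Nonempty α] (n : α → ℝ) (D : ℝ) (hn : ∀ x, 0 ≤ n x)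
    (h : ∑ x, n x = D) (x : α) : ratio n D x * D = n x := by
  unfold ratio; split_ifs with h0
  · rw [h0, mul_zero]
    rw [h0] at h
    exact ((Finset.sum_eq_zero_iff_of_nonneg fun x _ => hn x).1 h x (Finset.mem_univ x)).symm
  · exact div_mul_cancel₀ _ h0

lemma numF_nonneg (d : ℕ → X × U) (A : Ag M X U) (B : Beh M X U) (t : ℕ) (c : ℕ → CS M) (x : X)
    (m : Bool) : 0 ≤ numF d A B t c x m :=
  isum_nonneg _ _ _ fun w => mul_nonneg (mul_nonneg (Lw_nonneg A B c t w) (tr_nonneg A t c w x))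
    (B.f_nonneg _ _ _)

lemma numG_nonneg (d : ℕ → X × U) (A : Ag M X U) (B : Beh M X U) (t : ℕ) (c : ℕ → CS M) (x : X)
    (u : U) : 0 ≤ numG d A B t c x u :=
  isum_nonneg _ _ _ fun w => mul_nonneg (mul_nonneg (mul_nonneg (Lw_nonneg A B c t w)
    (tr_nonneg A t c w x)) (B.f_nonneg _ _ _)) (B.g_nonneg _ _ _)

lemma denF_nonneg (d : ℕ → X × U) (A : Ag M X U) (B : Beh M X U) (t : ℕ) (c : ℕ → CS M) (x : X) :
    0 ≤ denF d A B t c x :=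
  isum_nonneg _ _ _ fun w => mul_nonneg (Lw_nonneg A B c t w) (tr_nonneg A t c w x)

lemma numF_sum (d : ℕ → X × U) (A : Ag M X U) (B : Beh M X U) (t : ℕ) (c : ℕ → CS M) (x : X) :
    ∑ m, numF d A B t c x m = denF d A B t c x := by
  unfold numF denF
  simp only [← isum_sum, ← Finset.mul_sum, B.f_sum, mul_one]

lemma numG_sum (d : ℕ → X × U) (A : Ag M X U) (B : Beh M X U) (t : ℕ) (c : ℕ → CS M) (x : X) :
    ∑ u, numG d A B t c x u = numF d A B t c x (A.mi (c t).2.1) := by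
  unfold numF numG
  simp only [← isum_sum, ← Finset.mul_sum, B.g_sum, mul_one]

lemma denF_congr (d : ℕ → X × U) (A : Ag M X U) (B : Beh M X U) (t : ℕ) (c c' : ℕ → CS M)
    (h : tcm t c = tcm t c') (x : X) : denF d A B t c x = denF d A B t c' x := by
  have h' := tcm_agree h
  unfold denF
  simp only [Lw_congr A B c c' t h', tr_congr A t c c' h']

lemma numF_congr (d : ℕ → X × U) (A : Ag M X U) (B : Beh M X U) (t : ℕ) (c c' : ℕ → CS M)
    (h : tcm t c = tcm t c') (x : X) : numF d A B t c x = numF d A B t c' x := by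
  have h' := tcm_agree h
  funext m
  unfold numF
  simp only [Lw_congr A B c c' t h', tr_congr A t c c' h', h]

lemma numG_congr (d : ℕ → X × U) (A : Ag M X U) (B : Beh M X U) (t : ℕ) (c c' : ℕ → CS M)
    (h : tcp t c = tcp t c') (x : X) : numG d A B t c x = numG d A B t c' x := by
  obtain ⟨h1, h2⟩ := tcp_tcm h
  have h' := tcm_agree h1
  funext u
  unfold numG
  simp only [Lw_congr A B c c' t h', tr_congr A t c c' h', h, h1, h2]

/-- Lift a function of (common path, current state) to histories. -/
noncomputable def lift {α : Type} [Nonempty α] (tc : (ℕ → CS M) → HistC M) (t : ℕ)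
    (F : (ℕ → CS M) → X → α → ℝ) (h : HG M X U) : α → ℝ :=
  if hh : ∃ r : (ℕ → CS M) × (ℕ → X × U) × X, hG t (tc r.1) r.2.1 r.2.2 = h then
    F hh.choose.1 hh.choose.2.2 else pm

lemma lift_eq {α : Type} [Nonempty α] (tc : (ℕ → CS M) → HistC M) (t : ℕ)
    (F : (ℕ → CS M) → X → α → ℝ) (hF : ∀ c c' x, tc c = tc c' → F c x = F c' x)
    (c : ℕ → CS M) (w : ℕ → X × U) (x : X) : lift tc t F (hG t (tc c) w x) = F c x := by
  have hh : ∃ r : (ℕ → CS M) × (ℕ → X × U) × X, hG t (tc r.1) r.2.1 r.2.2 = hG t (tc c) w x :=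
    ⟨(c, w, x), rfl⟩
  unfold lift
  rw [dif_pos hh]
  obtain ⟨h1, h2⟩ := hG_inj hh.choose_spec
  rw [h2]
  exact hF _ _ _ h1

lemma lift_nonneg {α : Type} [Nonempty α] (tc : (ℕ → CS M) → HistC M) (t : ℕ)
    (F : (ℕ → CS M) → X → α → ℝ) (hF : ∀ c x a, 0 ≤ F c x a) (h : HG M X U) (a : α) :
    0 ≤ lift tc t F h a := by
  unfold lift
  split_ifs
  · exact hF _ _ _
  · exact pm_nonneg a

lemma lift_sum {α : Type} [Fintype α] [Nonempty α] (tc : (ℕ → CS M) → HistC M) (t : ℕ)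
    (F : (ℕ → CS M) → X → α → ℝ) (hF : ∀ c x, ∑ a, F c x a = 1) (h : HG M X U) :
    ∑ a, lift tc t F h a = 1 := by
  unfold lift
  split_ifs
  · exact hF _ _
  · exact pm_sum

/-- Single-agent reduction. -/
theorem agent_reduction [Nonempty U] (d : ℕ → X × U) (A : Ag M X U) (B : Beh M X U) :
    ∃ B' : Beh M X U,
      (∀ t c c' w w' x, tcm t c = tcm t c' →
        B'.f t (hG t (tcm t c) w x) = B'.f t (hG t (tcm t c') w' x)) ∧
      (∀ t c c' w w' x, tcp t c = tcp t c' →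
        B'.g t (hG t (tcp t c) w x) = B'.g t (hG t (tcp t c') w' x)) ∧
      ∀ c t (φ : X × U → ℝ),
        isum d (t+1) (fun w => Lw A B c (t+1) w * φ (w t)) =
        isum d (t+1) (fun w => Lw A B' c (t+1) w * φ (w t)) := by
  let a : (ℕ → CS M) → ℕ → X → Bool → ℝ := fun c t x =>
    ratio (numF d A B t c x) (denF d A B t c x)
  let b : (ℕ → CS M) → ℕ → X → U → ℝ := fun c t x =>
    ratio (numG d A B t c x) (numF d A B t c x (A.mi (c t).2.1))
  have ha : ∀ t c c' x, tcm t c = tcm t c' → a c t x = a c' t x := by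
    intro t c c' x h
    simp only [a, numF_congr d A B t c c' h, denF_congr d A B t c c' h]
  have hb : ∀ t c c' x, tcp t c = tcp t c' → b c t x = b c' t x := by
    intro t c c' x h
    simp only [b, numG_congr d A B t c c' h, numF_congr d A B t c c' (tcp_tcm h).1,
      (tcp_tcm h).2]
  let B' : Beh M X U :=
    { f := fun t h => lift (tcm t) t (fun c x => a c t x) h
      g := fun t h => lift (tcp t) t (fun c x => b c t x) h
      f_nonneg := fun t h m => lift_nonneg _ _ _ (fun c x m => ratio_nonneg _ _
        (numF_nonneg d A B t c x) (denF_nonneg d A B t c x) m) _ _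
      g_nonneg := fun t h m => lift_nonneg _ _ _ (fun c x m => ratio_nonneg _ _
        (numG_nonneg d A B t c x) (numF_nonneg d A B t c x _) m) _ _
      f_sum := fun t h => lift_sum _ _ _ (fun c x => ratio_sum _ _ (numF_sum d A B t c x)) _
      g_sum := fun t h => lift_sum _ _ _ (fun c x => ratio_sum _ _ (numG_sum d A B t c x)) _ }
  have hf : ∀ c t w x, B'.f t (hG t (tcm t c) w x) = a c t x := fun c t w x =>
    lift_eq (tcm t) t (fun c x => a c t x) (fun c c' x h => ha t c c' x h) c w x
  have hg : ∀ c t w x, B'.g t (hG t (tcp t c) w x) = b c t x := fun c t w x =>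
    lift_eq (tcp t) t (fun c x => b c t x) (fun c c' x h => hb t c c' x h) c w x
  refine ⟨B', ?_, ?_, ?_⟩
  · intro t c c' w w' x h
    rw [hf, hf, ha t c c' x h]
  · intro t c c' w w' x h
    rw [hg, hg, hb t c c' x h]
  · intro c t φ
    refine (den_eq d A B B' c (a c) (b c) ⟨?_, ?_, ?_, ?_⟩ t).2 φ
    · intro t w x m; rw [hf]
    · intro t w x u; rw [hg]
    · intro t x m
      exact ratio_mul _ _ (numF_nonneg d A B t c x) (numF_sum d A B t c x) m
    · intro t x u
      exact ratio_mul _ _ (numG_nonneg d A B t c x) (numG_sum d A B t c x) u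

end agent
section joint
variable {M : Model}

/-- One full step of the system, split into common and private parts. -/
abbrev SS (M : Model) := CS M × (M.X1 × M.U1) × (M.X2 × M.U2)

def stepOf (ω : Traj M) (t : ℕ) : SS M :=
  ((X0v ω t, (M1v ω t, M2v ω t), Zv ω t, Yv ω t, UAv ω t), (X1v ω t, U1v ω t),
    (X2v ω t, U2v ω t))

noncomputable def A1 (M : Model) : Ag M M.X1 M.U1 where
  ini := M.init1
  q := M.trans1
  mi := Prod.fst
  ze := fun c x => match c.2.2.1 with
    | none => 1
    | some p => if p.1 = x then 1 else 0
  ini_nonneg := M.init1_nonneg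
  q_nonneg := M.trans1_nonneg
  ze_nonneg := by
    intro c x
    rcases c.2.2.1 with _ | p
    · simp
    · dsimp only; split_ifs <;> norm_num

noncomputable def A2 (M : Model) : Ag M M.X2 M.U2 where
  ini := M.init2
  q := M.trans2
  mi := Prod.snd
  ze := fun c x => match c.2.2.1 with
    | none => 1
    | some p => if p.2 = x then 1 else 0
  ini_nonneg := M.init2_nonneg
  q_nonneg := M.trans2_nonneg
  ze_nonneg := by
    intro c x
    rcases c.2.2.1 with _ | p
    · simp
    · dsimp only; split_ifs <;> norm_num

noncomputable def z0 (c : CS M) : ℝ :=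
  if c.2.1 = (false, false) then (if c.2.2.1 = none then 1 else 0)
  else match c.2.2.1 with
    | none => M.pe c.1
    | some _ => 1 - M.pe c.1

lemma zKer_fac (c : CS M) (x1 : M.X1) (x2 : M.X2) :
    zKer M c.1 c.2.1 (x1, x2) c.2.2.1 = z0 c * (A1 M).ze c x1 * (A2 M).ze c x2 := by
  obtain ⟨x0, m, z, y, u⟩ := c
  rcases z with _ | ⟨p1, p2⟩
  · simp [zKer, z0, A1, A2]
  · by_cases hm : m = (false, false) <;> by_cases h1 : p1 = x1 <;> by_cases h2 : p2 = x2 <;>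
      simp [zKer, z0, A1, A2, hm, h1, h2]

lemma zKer_sum (x0 : M.X0) (m : Bool × Bool) (x : M.X1 × M.X2) :
    ∑ z, zKer M x0 m x z = 1 := by
  by_cases hm : m = (false, false) <;> simp [zKer, hm, Fintype.sum_option]

def B1 (σ : TeamStrategy M) : Beh M M.X1 M.U1 :=
  ⟨σ.f1, σ.g1, σ.f1_nonneg, σ.g1_nonneg, σ.f1_sum, σ.g1_sum⟩

def B2 (σ : TeamStrategy M) : Beh M M.X2 M.U2 :=
  ⟨σ.f2, σ.g2, σ.f2_nonneg, σ.g2_nonneg, σ.f2_sum, σ.g2_sum⟩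

def t0 : ℕ → (ℕ → CS M) → M.X0 → ℝ
  | 0, _, x => M.init0 x
  | t+1, c, x => M.trans0 (c t).1 (c t).2.2.2.2 x

lemma t0_congr (t : ℕ) (c c' : ℕ → CS M) (h : ∀ s, s < t → c s = c' s) (x : M.X0) :
    t0 t c x = t0 t c' x := by
  cases t with
  | zero => rfl
  | succ t => simp only [t0]; rw [h t (by omega)]

/-- Common factor of the trajectory probability at time `t`. -/
noncomputable def K0 (α : ℕ → HistC M → M.Ua → ℝ) (t : ℕ) (c : ℕ → CS M) : ℝ :=
  t0 t c (c t).1 * z0 (c t) * M.obs (c t).2.2.1 (c t).2.1 (c t).1 (c t).2.2.2.1 *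
    α t (tcp t c) (c t).2.2.2.2

lemma K0_congr (α : ℕ → HistC M → M.Ua → ℝ) (t : ℕ) (c c' : ℕ → CS M)
    (h : ∀ s, s ≤ t → c s = c' s) : K0 α t c = K0 α t c' := by
  simp only [K0, t0_congr t c c' (fun s hs => h s hs.le), tcp_congr h, h t le_rfl]

lemma Lfac_congr_w {X U : Type} [Fintype X] [Fintype U] (A : Ag M X U) (B : Beh M X U)
    (c : ℕ → CS M) (t : ℕ) (w w' : ℕ → X × U)
    (h : ∀ s, s < t → w s = w' s) (p : X × U) :
    Lfac A B c t w p = Lfac A B c t w' p := by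
  have h1 : ∀ x, A.tr t c w x = A.tr t c w' x := by
    intro x
    cases t with
    | zero => rfl
    | succ t => simp only [Ag.tr]; rw [h t (by omega)]
  have h2 : ∀ (k : HistC M) (x : X), hG t k w x = hG t k w' x := by
    intro k x
    simp only [hG]
    rw [pre_congr t (f := fun s => (w s).1) (g := fun s => (w' s).1)
      (fun s hs => by simp only [h s hs]),
      pre_congr t (f := fun s => (w s).2) (g := fun s => (w' s).2)
      (fun s hs => by simp only [h s hs])]
  simp only [Lfac, h1, h2]

/-- One-step factor of the trajectory probability. -/
noncomputable def KK (α : ℕ → HistC M → M.Ua → ℝ) (σ : TeamStrategy M) (t : ℕ)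
    (w : ℕ → SS M) : ℝ :=
  K0 α t (fun s => (w s).1) *
    Lfac (A1 M) (B1 σ) (fun s => (w s).1) t (fun s => (w s).2.1) (w t).2.1 *
    Lfac (A2 M) (B2 σ) (fun s => (w s).1) t (fun s => (w s).2.2) (w t).2.2

lemma KK_congr (α : ℕ → HistC M → M.Ua → ℝ) (σ : TeamStrategy M) (t : ℕ)
    (w w' : ℕ → SS M) (h : ∀ s, s ≤ t → w s = w' s) : KK α σ t w = KK α σ t w' := by
  have hc : ∀ s, s ≤ t → (w s).1 = (w' s).1 := fun s hs => by rw [h s hs]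
  have h1 : ∀ s, s < t → (w s).2.1 = (w' s).2.1 := fun s hs => by rw [h s hs.le]
  have h2 : ∀ s, s < t → (w s).2.2 = (w' s).2.2 := fun s hs => by rw [h s hs.le]
  unfold KK
  rw [K0_congr α t _ _ hc, Lfac_congr (A1 M) (B1 σ) _ _ t hc, Lfac_congr (A2 M) (B2 σ) _ _ t hc,
    Lfac_congr_w (A1 M) (B1 σ) _ t _ _ h1, Lfac_congr_w (A2 M) (B2 σ) _ t _ _ h2, h t le_rfl]

/-- Reordering of a step in chronological order. -/
def reord (M : Model) : (M.X0 × M.X1 × M.X2 × (Bool × Bool) × Option (M.X1 × M.X2) × M.Y ×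
    M.U1 × M.U2 × M.Ua) ≃ SS M where
  toFun r := ((r.1, r.2.2.2.1, r.2.2.2.2.1, r.2.2.2.2.2.1, r.2.2.2.2.2.2.2.2),
    (r.2.1, r.2.2.2.2.2.2.1), (r.2.2.1, r.2.2.2.2.2.2.2.1))
  invFun s := (s.1.1, s.2.1.1, s.2.2.1, s.1.2.1, s.1.2.2.1, s.1.2.2.2.1, s.2.1.2, s.2.2.2,
    s.1.2.2.2.2)
  left_inv _ := rfl
  right_inv _ := rfl

lemma norm_abs (T0 : M.X0 → ℝ) (T1 : M.X1 → ℝ) (T2 : M.X2 → ℝ)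
    (F1 : M.X0 → M.X1 → Bool → ℝ) (F2 : M.X0 → M.X2 → Bool → ℝ)
    (G1 : M.X0 → Bool × Bool → Option (M.X1 × M.X2) → M.Y → M.X1 → M.U1 → ℝ)
    (G2 : M.X0 → Bool × Bool → Option (M.X1 × M.X2) → M.Y → M.X2 → M.U2 → ℝ)
    (Al : M.X0 → Bool × Bool → Option (M.X1 × M.X2) → M.Y → M.Ua → ℝ)
    (hT0 : ∑ x, T0 x = 1) (hT1 : ∑ x, T1 x = 1) (hT2 : ∑ x, T2 x = 1)
    (hF1 : ∀ a b, ∑ x, F1 a b x = 1) (hF2 : ∀ a b, ∑ x, F2 a b x = 1)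
    (hG1 : ∀ a b c d e, ∑ x, G1 a b c d e x = 1) (hG2 : ∀ a b c d e, ∑ x, G2 a b c d e x = 1)
    (hAl : ∀ a b c d, ∑ x, Al a b c d x = 1) :
    ∑ s : SS M, (T0 s.1.1 * z0 s.1 * M.obs s.1.2.2.1 s.1.2.1 s.1.1 s.1.2.2.2.1 *
        Al s.1.1 s.1.2.1 s.1.2.2.1 s.1.2.2.2.1 s.1.2.2.2.2) *
      (T1 s.2.1.1 * F1 s.1.1 s.2.1.1 s.1.2.1.1 * (A1 M).ze s.1 s.2.1.1 *
        G1 s.1.1 s.1.2.1 s.1.2.2.1 s.1.2.2.2.1 s.2.1.1 s.2.1.2) *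
      (T2 s.2.2.1 * F2 s.1.1 s.2.2.1 s.1.2.1.2 * (A2 M).ze s.1 s.2.2.1 *
        G2 s.1.1 s.1.2.1 s.1.2.2.1 s.1.2.2.2.1 s.2.2.1 s.2.2.2) = 1 := by
  have e1 : ∀ s : SS M, (T0 s.1.1 * z0 s.1 * M.obs s.1.2.2.1 s.1.2.1 s.1.1 s.1.2.2.2.1 *
        Al s.1.1 s.1.2.1 s.1.2.2.1 s.1.2.2.2.1 s.1.2.2.2.2) *
      (T1 s.2.1.1 * F1 s.1.1 s.2.1.1 s.1.2.1.1 * (A1 M).ze s.1 s.2.1.1 *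
        G1 s.1.1 s.1.2.1 s.1.2.2.1 s.1.2.2.2.1 s.2.1.1 s.2.1.2) *
      (T2 s.2.2.1 * F2 s.1.1 s.2.2.1 s.1.2.1.2 * (A2 M).ze s.1 s.2.2.1 *
        G2 s.1.1 s.1.2.1 s.1.2.2.1 s.1.2.2.2.1 s.2.2.1 s.2.2.2) =
      T0 s.1.1 * (T1 s.2.1.1 * (T2 s.2.2.1 * (F1 s.1.1 s.2.1.1 s.1.2.1.1 *
        F2 s.1.1 s.2.2.1 s.1.2.1.2 * (zKer M s.1.1 s.1.2.1 (s.2.1.1, s.2.2.1) s.1.2.2.1 *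
        (M.obs s.1.2.2.1 s.1.2.1 s.1.1 s.1.2.2.2.1 *
        (G1 s.1.1 s.1.2.1 s.1.2.2.1 s.1.2.2.2.1 s.2.1.1 s.2.1.2 *
        (G2 s.1.1 s.1.2.1 s.1.2.2.1 s.1.2.2.2.1 s.2.2.1 s.2.2.2 *
        Al s.1.1 s.1.2.1 s.1.2.2.1 s.1.2.2.2.1 s.1.2.2.2.2))))))) := by
    intro s
    rw [zKer_fac]; ring
  have hFF : ∀ a b b', ∑ m : Bool × Bool, F1 a b m.1 * F2 a b' m.2 = 1 := by
    intro a b b'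
    simp only [Fintype.sum_prod_type, ← Finset.mul_sum, hF1, hF2, mul_one]
  rw [Finset.sum_congr rfl (fun s _ => e1 s), ← (reord M).sum_comp]
  have hp : ∀ {P Q : Type} [Fintype P] [Fintype Q] (f : P × Q → ℝ),
    ∑ x, f x = ∑ x, ∑ y, f (x, y) := fun f => Fintype.sum_prod_type f
  rw [hp]
  simp only [hp (P := M.X1), hp (P := M.X2), hp (P := Bool × Bool),
    hp (P := Option (M.X1 × M.X2)), hp (P := M.Y), hp (P := M.U1), hp (P := M.U2)]
  simp only [reord, Equiv.coe_fn_mk, ← Finset.mul_sum, hAl, hG1, hG2, M.obs_sum, zKer_sum, hFF,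
    hT0, hT1, hT2, mul_one]

def tcmU (n : ℕ) (c : ℕ → CS M) (x : M.X0) : HistC M :=
  (pre n (fun s => (c s).1) ++ [x], pre n (fun s => (c s).2.1), pre n (fun s => (c s).2.2.1),
    pre n (fun s => (c s).2.2.2.2), pre n (fun s => (c s).2.2.2.1))

def tcpU (n : ℕ) (c : ℕ → CS M) (x : M.X0) (m : Bool × Bool) (z : Option (M.X1 × M.X2))
    (y : M.Y) : HistC M :=
  (pre n (fun s => (c s).1) ++ [x], pre n (fun s => (c s).2.1) ++ [m],
    pre n (fun s => (c s).2.2.1) ++ [z],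
    pre n (fun s => (c s).2.2.2.2), pre n (fun s => (c s).2.2.2.1) ++ [y])

lemma pre_upd {α β : Type} (n : ℕ) (c : ℕ → α) (e : α) (F : α → β) :
    pre n (fun s => F (Function.update c n e s)) = pre n (fun s => F (c s)) :=
  pre_congr n fun s hs => by rw [Function.update_of_ne (by omega)]

lemma tcm_upd (n : ℕ) (c : ℕ → CS M) (e : CS M) :
    tcm n (Function.update c n e) = tcmU n c e.1 := by
  simp only [tcm, tcmU, pre_succ, Function.update_self]
  rw [pre_upd n c e (fun a => a.1), pre_upd n c e (fun a => a.2.1),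
    pre_upd n c e (fun a => a.2.2.1), pre_upd n c e (fun a => a.2.2.2.1),
    pre_upd n c e (fun a => a.2.2.2.2)]

lemma tcp_upd (n : ℕ) (c : ℕ → CS M) (e : CS M) :
    tcp n (Function.update c n e) = tcpU n c e.1 e.2.1 e.2.2.1 e.2.2.2.1 := by
  simp only [tcp, tcpU, pre_succ, Function.update_self]
  rw [pre_upd n c e (fun a => a.1), pre_upd n c e (fun a => a.2.1),
    pre_upd n c e (fun a => a.2.2.1), pre_upd n c e (fun a => a.2.2.2.1),
    pre_upd n c e (fun a => a.2.2.2.2)]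

lemma upd_proj {α β : Type} (n : ℕ) (w : ℕ → α) (e : α) (F : α → β) :
    (fun s => F (Function.update w n e s)) = Function.update (fun s => F (w s)) n (F e) := by
  funext s
  by_cases h : s = n
  · subst h; simp
  · simp [h]

lemma KK_norm (α : ℕ → HistC M → M.Ua → ℝ) (hα : ∀ t k, ∑ u, α t k u = 1)
    (σ : TeamStrategy M) (n : ℕ) (w : ℕ → SS M) :
    ∑ s, KK α σ n (Function.update w n s) = 1 := by
  set c : ℕ → CS M := fun s => (w s).1 with hc
  set p1 : ℕ → M.X1 × M.U1 := fun s => (w s).2.1 with hp1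
  set p2 : ℕ → M.X2 × M.U2 := fun s => (w s).2.2 with hp2
  have e : ∀ s, KK α σ n (Function.update w n s) =
      (t0 n c s.1.1 * z0 s.1 * M.obs s.1.2.2.1 s.1.2.1 s.1.1 s.1.2.2.2.1 *
        α n (tcpU n c s.1.1 s.1.2.1 s.1.2.2.1 s.1.2.2.2.1) s.1.2.2.2.2) *
      ((A1 M).tr n c p1 s.2.1.1 * σ.f1 n (hG n (tcmU n c s.1.1) p1 s.2.1.1) s.1.2.1.1 *
        (A1 M).ze s.1 s.2.1.1 *
        σ.g1 n (hG n (tcpU n c s.1.1 s.1.2.1 s.1.2.2.1 s.1.2.2.2.1) p1 s.2.1.1) s.2.1.2) *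
      ((A2 M).tr n c p2 s.2.2.1 * σ.f2 n (hG n (tcmU n c s.1.1) p2 s.2.2.1) s.1.2.1.2 *
        (A2 M).ze s.1 s.2.2.1 *
        σ.g2 n (hG n (tcpU n c s.1.1 s.1.2.1 s.1.2.2.1 s.1.2.2.2.1) p2 s.2.2.1) s.2.2.2) := by
    intro s
    have hag : ∀ r, r < n → Function.update c n s.1 r = c r := fun r hr =>
      Function.update_of_ne (by omega) _ _
    unfold KK
    rw [upd_proj n w s (fun a => a.1), upd_proj n w s (fun a => a.2.1),
      upd_proj n w s (fun a => a.2.2), Function.update_self, Lfac_update _ _ _ n n le_rfl,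
      Lfac_update _ _ _ n n le_rfl]
    unfold K0 Lfac
    rw [tcm_upd, tcp_upd, Function.update_self, tr_congr _ n _ _ hag, tr_congr _ n _ _ hag,
      t0_congr n _ _ hag]
    rfl
  rw [Finset.sum_congr rfl (fun s _ => e s)]
  refine norm_abs (t0 n c) ((A1 M).tr n c p1) ((A2 M).tr n c p2)
    (fun x0 x1 m => σ.f1 n (hG n (tcmU n c x0) p1 x1) m)
    (fun x0 x2 m => σ.f2 n (hG n (tcmU n c x0) p2 x2) m)
    (fun x0 m z y x1 u => σ.g1 n (hG n (tcpU n c x0 m z y) p1 x1) u)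
    (fun x0 m z y x2 u => σ.g2 n (hG n (tcpU n c x0 m z y) p2 x2) u)
    (fun x0 m z y u => α n (tcpU n c x0 m z y) u) ?_ ?_ ?_ ?_ ?_ ?_ ?_ ?_
  · cases n with
    | zero => exact M.init0_sum
    | succ n => exact M.trans0_sum _ _
  · cases n with
    | zero => exact M.init1_sum
    | succ n => exact M.trans1_sum _ _ _
  · cases n with
    | zero => exact M.init2_sum
    | succ n => exact M.trans2_sum _ _ _
  · intros; exact σ.f1_sum _ _
  · intros; exact σ.f2_sum _ _
  · intros; exact σ.g1_sum _ _
  · intros; exact σ.g2_sum _ _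
  · intros; exact hα _ _

lemma trunc (d : ℕ → SS M) (α : ℕ → HistC M → M.Ua → ℝ) (hα : ∀ t k, ∑ u, α t k u = 1)
    (σ : TeamStrategy M) (t k : ℕ) (φ : SS M → ℝ) :
    isum d (t + 1 + k) (fun w => (∏ s ∈ Finset.range (t + 1 + k), KK α σ s w) * φ (w t)) =
    isum d (t + 1) (fun w => (∏ s ∈ Finset.range (t + 1), KK α σ s w) * φ (w t)) := by
  induction k with
  | zero => rfl
  | succ k ih =>
    rw [← ih, ← add_assoc, isum]
    congr 1
    funext w
    have : ∀ s, (∏ r ∈ Finset.range (t + 1 + k + 1),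
        KK α σ r (Function.update w (t + 1 + k) s)) * φ (Function.update w (t + 1 + k) s t) =
        ((∏ r ∈ Finset.range (t + 1 + k), KK α σ r w) * φ (w t)) *
          KK α σ (t + 1 + k) (Function.update w (t + 1 + k) s) := by
      intro s
      rw [Finset.prod_range_succ, Function.update_of_ne (by omega : t ≠ t + 1 + k)]
      rw [Finset.prod_congr rfl (fun r hr => KK_congr α σ r (Function.update w (t+1+k) s) w
        (fun q hq => Function.update_of_ne (by have := Finset.mem_range.1 hr; omega) _ _))]
      ring
    simp only [this, ← Finset.mul_sum, KK_norm α hα, mul_one]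

noncomputable def kap (t : ℕ) (s : SS M) : ℝ :=
  M.cost t s.1.1 (s.2.1.1, s.2.2.1) (s.2.1.2, s.2.2.2) s.1.2.2.2.2 +
    (if (s.1.2.1.1 || s.1.2.1.2) then M.commCost s.1.1 (s.2.1.1, s.2.2.1) else 0)

noncomputable def alph (IS : InfoStructure M) (γ : AdvStrategy M IS.C) (t : ℕ) (k : HistC M) :
    M.Ua → ℝ :=
  if h : ∃ ω, teamComP t ω = k then γ.ga t (IS.infoCp t h.choose) else pm

lemma alph_sum (IS : InfoStructure M) (γ : AdvStrategy M IS.C) (t : ℕ) (k : HistC M) :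
    ∑ u, alph IS γ t k u = 1 := by
  unfold alph; split_ifs
  · exact γ.ga_sum _ _
  · exact pm_sum

lemma alph_eq (IS : InfoStructure M) (γ : AdvStrategy M IS.C) (t : ℕ) (ω : Traj M) :
    alph IS γ t (teamComP t ω) = γ.ga t (IS.infoCp t ω) := by
  have h : ∃ ω', teamComP t ω' = teamComP t ω := ⟨ω, rfl⟩
  unfold alph
  rw [dif_pos h, ((IS.cdp_team t _ _).2 h.choose_spec).1]

lemma info1_eq (t : ℕ) (ω : Traj M) : info1 t ω =
    hG t (tcm t (fun s => (stepOf ω s).1)) (fun s => (stepOf ω s).2.1) (X1v ω t) := by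
  simp only [info1, pre_succ t (X1v ω)]; rfl

lemma info2_eq (t : ℕ) (ω : Traj M) : info2 t ω =
    hG t (tcm t (fun s => (stepOf ω s).1)) (fun s => (stepOf ω s).2.2) (X2v ω t) := by
  simp only [info2, pre_succ t (X2v ω)]; rfl

lemma info1p_eq (t : ℕ) (ω : Traj M) : info1p t ω =
    hG t (tcp t (fun s => (stepOf ω s).1)) (fun s => (stepOf ω s).2.1) (X1v ω t) := by
  simp only [info1p, pre_succ t (X1v ω)]; rfl

lemma info2p_eq (t : ℕ) (ω : Traj M) : info2p t ω =
    hG t (tcp t (fun s => (stepOf ω s).1)) (fun s => (stepOf ω s).2.2) (X2v ω t) := by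
  simp only [info2p, pre_succ t (X2v ω)]; rfl

lemma prob_eq (IS : InfoStructure M) (γ : AdvStrategy M IS.C) (σ : TeamStrategy M)
    (ω : Traj M) : prob σ γ IS.infoCp ω =
      ∏ t ∈ Finset.range M.T, KK (alph IS γ) σ t (stepOf ω) := by
  let τ : ℕ → ℝ := fun t => t0 t (fun s => (stepOf ω s).1) (X0v ω t) *
    (A1 M).tr t (fun s => (stepOf ω s).1) (fun s => (stepOf ω s).2.1) (X1v ω t) *
    (A2 M).tr t (fun s => (stepOf ω s).1) (fun s => (stepOf ω s).2.2) (X2v ω t)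
  have hτ : ∀ N, 0 < N → ∏ t ∈ Finset.range N, τ t =
      τ 0 * ∏ t ∈ Finset.range (N - 1), τ (t+1) := by
    intro N hN
    obtain ⟨n, rfl⟩ : ∃ n, N = n + 1 := ⟨N - 1, by omega⟩
    rw [Finset.prod_range_succ', mul_comm]; rfl
  have hK : ∀ t, KK (alph IS γ) σ t (stepOf ω) =
    (σ.f1 t (info1 t ω) (M1v ω t) * σ.f2 t (info2 t ω) (M2v ω t) *
     zKer M (X0v ω t) (Mv ω t) (X1v ω t, X2v ω t) (Zv ω t) *
     M.obs (Zv ω t) (Mv ω t) (X0v ω t) (Yv ω t) *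
     σ.g1 t (info1p t ω) (U1v ω t) * σ.g2 t (info2p t ω) (U2v ω t) *
     γ.ga t (IS.infoCp t ω) (UAv ω t)) * τ t := by
    intro t
    have hz := zKer_fac (stepOf ω t).1 (X1v ω t) (X2v ω t)
    have hz' : zKer M (X0v ω t) (Mv ω t) (X1v ω t, X2v ω t) (Zv ω t) =
      z0 (stepOf ω t).1 * (A1 M).ze (stepOf ω t).1 (X1v ω t) *
        (A2 M).ze (stepOf ω t).1 (X2v ω t) := hz
    rw [hz', ← alph_eq, info1_eq, info2_eq, info1p_eq, info2p_eq]
    have : teamComP t ω = tcp t (fun s => (stepOf ω s).1) := rfl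
    rw [this]
    simp only [KK, K0, Lfac, τ]
    simp only [stepOf, B1, B2, A1, A2, Mv]
    ring
  rw [Finset.prod_congr rfl (fun t _ => hK t), Finset.prod_mul_distrib, hτ M.T M.hT]
  unfold prob
  simp only [τ, t0, Ag.tr, stepOf, A1, A2]
  ring

def trajEquiv (M : Model) : Traj M ≃ (Fin M.T → SS M) where
  toFun ω i := ((ω.1 i, (ω.2.2.2.1 i, ω.2.2.2.2.1 i), ω.2.2.2.2.2.1 i, ω.2.2.2.2.2.2.1 i,
    ω.2.2.2.2.2.2.2.2.2 i), (ω.2.1 i, ω.2.2.2.2.2.2.2.1 i),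
    (ω.2.2.1 i, ω.2.2.2.2.2.2.2.2.1 i))
  invFun v := (fun i => (v i).1.1, fun i => (v i).2.1.1, fun i => (v i).2.2.1,
    fun i => (v i).1.2.1.1, fun i => (v i).1.2.1.2, fun i => (v i).1.2.2.1,
    fun i => (v i).1.2.2.2.1, fun i => (v i).2.1.2, fun i => (v i).2.2.2,
    fun i => (v i).1.2.2.2.2)
  left_inv _ := rfl
  right_inv _ := rfl

lemma ext_step (d : ℕ → SS M) (ω : Traj M) (t : ℕ) (ht : t < M.T) :
    ext d M.T (trajEquiv M ω) t = stepOf ω t := by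
  have : idx M t = ⟨t, ht⟩ := by simp [idx, ht]
  simp only [ext, ht, dite_true, stepOf, X0v, X1v, X2v, M1v, M2v, Zv, Yv, U1v, U2v, UAv, this]
  rfl

lemma J_eq (IS : InfoStructure M) (γ : AdvStrategy M IS.C) (σ : TeamStrategy M)
    (dc : ℕ → CS M) (d1 : ℕ → M.X1 × M.U1) (d2 : ℕ → M.X2 × M.U2) :
    J σ γ IS.infoCp = ∑ t ∈ Finset.range M.T,
      isum dc (t+1) (fun c => (∏ s ∈ Finset.range (t+1), K0 (alph IS γ) s c) *
        isum d1 (t+1) (fun p1 => Lw (A1 M) (B1 σ) c (t+1) p1 *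
          isum d2 (t+1) (fun p2 => Lw (A2 M) (B2 σ) c (t+1) p2 *
            kap t (c t, p1 t, p2 t)))) := by
  set d : ℕ → SS M := fun t => (dc t, (fun s => (d1 s, d2 s)) t) with hd
  have h1 : J σ γ IS.infoCp = isum d M.T (fun w =>
      ∑ t ∈ Finset.range M.T, (∏ s ∈ Finset.range M.T, KK (alph IS γ) σ s w) * kap t (w t)) := by
    rw [← sum_ext, ← (trajEquiv M).sum_comp]
    unfold J
    refine Finset.sum_congr rfl fun ω _ => ?_
    rw [prob_eq, ← Finset.mul_sum]
    congr 1
    · refine Finset.prod_congr rfl fun s hs => KK_congr _ _ _ _ _ fun r hr => ?_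
      have := Finset.mem_range.1 hs
      rw [ext_step d ω r (by omega)]
    · unfold totalCost
      refine Finset.sum_congr rfl fun t ht => ?_
      rw [ext_step d ω t (Finset.mem_range.1 ht)]
      rfl
  rw [h1, isum_sum]
  refine Finset.sum_congr rfl fun t ht => ?_
  obtain ⟨k, hk⟩ : ∃ k, M.T = t + 1 + k :=
    ⟨M.T - (t + 1), by have := Finset.mem_range.1 ht; omega⟩
  rw [hk, trunc d _ (alph_sum IS γ) σ t k (kap t), hd, isum_prod]
  congr 1
  funext c
  rw [isum_prod, ← isum_mul_left]
  congr 1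
  funext p1
  rw [← isum_mul_left, ← isum_mul_left]
  congr 1
  funext p2
  simp only [KK, Finset.prod_mul_distrib, Lw]
  ring

theorem reduction (IS : InfoStructure M) (σ : TeamStrategy M) :
    ∃ σ' : TeamStrategy M, Simplified IS σ' ∧
      ∀ γ : AdvStrategy M IS.C, J σ γ IS.infoCp = J σ' γ IS.infoCp := by
  let dc : ℕ → CS M := fun _ => Classical.arbitrary _
  let d1 : ℕ → M.X1 × M.U1 := fun _ => Classical.arbitrary _
  let d2 : ℕ → M.X2 × M.U2 := fun _ => Classical.arbitrary _
  obtain ⟨C1, hf1, hg1, hC1⟩ := agent_reduction d1 (A1 M) (B1 σ)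
  obtain ⟨C2, hf2, hg2, hC2⟩ := agent_reduction d2 (A2 M) (B2 σ)
  let σ' : TeamStrategy M := ⟨C1.f, C2.f, C1.g, C2.g, C1.f_nonneg, C2.f_nonneg, C1.g_nonneg,
    C2.g_nonneg, C1.f_sum, C2.f_sum, C1.g_sum, C2.g_sum⟩
  refine ⟨σ', ⟨?_, ?_, ?_, ?_⟩, ?_⟩
  · intro t ω ω' hx hc hd
    have h := (IS.cd_team t ω ω').1 ⟨hc, hd⟩
    rw [info1_eq, info1_eq, hx]
    exact hf1 t _ _ _ _ _ h
  · intro t ω ω' hx hc hd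
    have h := (IS.cd_team t ω ω').1 ⟨hc, hd⟩
    rw [info2_eq, info2_eq, hx]
    exact hf2 t _ _ _ _ _ h
  · intro t ω ω' hx hc hd
    have h := (IS.cdp_team t ω ω').1 ⟨hc, hd⟩
    rw [info1p_eq, info1p_eq, hx]
    exact hg1 t _ _ _ _ _ h
  · intro t ω ω' hx hc hd
    have h := (IS.cdp_team t ω ω').1 ⟨hc, hd⟩
    rw [info2p_eq, info2p_eq, hx]
    exact hg2 t _ _ _ _ _ h
  · intro γ
    rw [J_eq IS γ σ dc d1 d2, J_eq IS γ σ' dc d1 d2]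
    refine Finset.sum_congr rfl fun t _ => ?_
    congr 1
    funext c
    congr 1
    have e2 : ∀ p1 : ℕ → M.X1 × M.U1,
        isum d2 (t+1) (fun p2 => Lw (A2 M) (B2 σ) c (t+1) p2 * kap t (c t, p1 t, p2 t)) =
        isum d2 (t+1) (fun p2 => Lw (A2 M) (B2 σ') c (t+1) p2 * kap t (c t, p1 t, p2 t)) :=
      fun p1 => hC2 c t (fun b => kap t (c t, p1 t, b))
    simp only [e2]
    exact hC1 c t (fun a => isum d2 (t+1) (fun p2 => Lw (A2 M) (B2 σ') c (t+1) p2 *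
      kap t (c t, a, p2 t)))

end joint

/-- Proposition 1 of the paper: each agent can restrict itself to
strategies of the form `Mⁱ_t ∼ f̄ⁱ_t(Xⁱ_t, C_t, D_t)`, `Uⁱ_t ∼ ḡⁱ_t(Xⁱ_t, C_{t⁺}, D_{t⁺})`
without loss of optimality: the min-max value over all team strategies equals the min-max
value over simplified strategies. -/
theorem proposition1 (M : Model) (IS : InfoStructure M) :
    (⨅ σ : TeamStrategy M, ⨆ γ : AdvStrategy M IS.C, J σ γ IS.infoCp)
      = ⨅ σ : {σ : TeamStrategy M // Simplified IS σ},
          ⨆ γ : AdvStrategy M IS.C, J σ.1 γ IS.infoCp := by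
  apply congrArg sInf
  apply Set.Subset.antisymm
  · rintro _ ⟨σ, rfl⟩
    obtain ⟨σ', hs, h⟩ := reduction IS σ
    exact ⟨⟨σ', hs⟩, by simp only [h]⟩
  · rintro _ ⟨σ, rfl⟩
    exact ⟨σ.1, rfl⟩

end TA
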